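/- arXiv:math/0604224 — 2 statements merged into one kernel-verified Lean document; each statement's English description precedes it below -/
import Mathlib

section
/- For every p-regular conjugacy class C of G, the idempotent e_C (the characteristic class function of the p'-section S_{p'}(C)) belongs to 𝒪_𝔭R(G), and it is a primitive idempotent of the ring 𝒪_𝔭R(G). Moreover the family (e_C), with C running over the p-regular conjugacy classes of G, consists of pairwise orthogonal primitive idempotents whose sum is 1. -/
open scoped TensorProduct Classical

/-! Common definitions: the character ring of a finite group, following Bonnafé,
"On the character ring of a finite group". -/

/-- The set of characters of finite-dimensional `K`-linear representations of `G`. -/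
def charSet (K G : Type u) [Field K] [Group G] : Set (G → K) :=
  {f | ∃ V : FDRep K G, f = FDRep.character V}

/-- The character ring `R(G)` of virtual characters, i.e. the subring of the `K`-algebra of
functions `G → K` generated by the characters.  Over a splitting field of characteristic zero
this is exactly the set of `ℤ`-linear combinations of irreducible characters. -/
def charRing (K G : Type u) [Field K] [Group G] : Subring (G → K) :=
  Subring.closure (charSet K G)

/-- `g` is `p`-regular if its order is prime to `p`. -/
def IsPRegular (p : ℕ) {G : Type*} [Monoid G] (g : G) : Prop :=
  Nat.Coprime (orderOf g) p

/-- `g` is a `p`-element if its order is a power of `p`. -/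
def IsPElement (p : ℕ) {G : Type*} [Monoid G] (g : G) : Prop :=
  ∃ n : ℕ, orderOf g = p ^ n

/-- The `p'`-part `g_{p'}` of an element `g` of a finite group:  writing `orderOf g = q * m'`
with `q` the `p`-part of the order, this is `g ^ (q * u)` where `u` is the inverse of
`q` modulo `m'`; it is the unique `p`-regular power of `g` such that `g * g_{p'}⁻¹` is a
`p`-element commuting with it. -/
noncomputable def pPrimePart (p : ℕ) {G : Type*} [Group G] (g : G) : G :=
  g ^ (p ^ (orderOf g).factorization p *
      (((p : ZMod (orderOf g / p ^ (orderOf g).factorization p)) ^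
        (orderOf g).factorization p)⁻¹).val)

/-- The `p'`-section `S_{p'}(C)` of the conjugacy class `C` of `g` : the set of all
`x ∈ G` whose `p'`-part lies in the class of `g`. -/
def pSection (p : ℕ) {G : Type*} [Group G] (g : G) : Set G :=
  {x | IsConj g (pPrimePart p x)}

/-- The idempotent class function `e_C` attached to the class `C` of `g`:  the characteristic
function (with values in `K`) of the `p'`-section of `C`. -/
noncomputable def eFun (p : ℕ) (K : Type*) [Field K] {G : Type*} [Group G] (g : G) : G → K :=
  fun x => if IsConj g (pPrimePart p x) then 1 else 0

/-- The number of conjugacy classes of `G` contained in a subset `S`. -/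
noncomputable def numClassesIn {G : Type*} [Group G] (S : Set G) : ℕ :=
  Nat.card {c : ConjClasses G // c.carrier ⊆ S}

/-- The image of the localization `𝒪_𝔭` in the fraction field `K`: fractions `a / b` with
`b ∉ 𝔭`. -/
def locSet (𝒪 K : Type*) [CommRing 𝒪] [Field K] [Algebra 𝒪 K] (𝔭 : Ideal 𝒪) : Set K :=
  {x | ∃ a b : 𝒪, b ∉ 𝔭 ∧ x * algebraMap 𝒪 K b = algebraMap 𝒪 K a}

/-- `𝒪_𝔭 R(G)`: the `𝒪_𝔭`-span of the character ring inside class functions `G → K`,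
realized as the subring generated by `𝒪_𝔭`-constants and characters. -/
def locCharRing (𝒪 : Type*) (K : Type u) [CommRing 𝒪] [Field K] [Algebra 𝒪 K] (𝔭 : Ideal 𝒪)
    (G : Type u) [Group G] : Subring (G → K) :=
  Subring.closure ({f | ∃ x ∈ locSet 𝒪 K 𝔭, f = Function.const G x} ∪ charSet K G)

/-- The ideal `𝔭 · 𝒪_𝔭R(G)` of `𝒪_𝔭R(G)`, generated by the constants from `𝔭`. -/
def pConstIdeal (𝒪 : Type*) (K : Type u) [CommRing 𝒪] [Field K] [Algebra 𝒪 K] (𝔭 : Ideal 𝒪)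
    (G : Type u) [Group G] : Ideal (locCharRing 𝒪 K 𝔭 G) :=
  Ideal.span {f | ∃ a ∈ 𝔭, (f : G → K) = Function.const G (algebraMap 𝒪 K a)}

/-- `kR(G) = k ⊗_ℤ R(G)`, realized through the canonical identification
`k ⊗_ℤ R(G) ≅ 𝒪_𝔭R(G) ⧸ 𝔭·𝒪_𝔭R(G)` (where `k = 𝒪/𝔭`). -/
abbrev kCharRing (𝒪 : Type*) (K : Type u) [CommRing 𝒪] [Field K] [Algebra 𝒪 K] (𝔭 : Ideal 𝒪)
    (G : Type u) [Group G] :=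
  locCharRing 𝒪 K 𝔭 G ⧸ pConstIdeal 𝒪 K 𝔭 G

/-- The ideal of `𝒪_𝔭R(G)` cutting out the block `R_𝔭(G, C)` with identity element the
idempotent `e : 𝒪_𝔭R(G)`, reduced mod `𝔭`:  the block `kR(G)·ē` is canonically the quotient
by `𝔭·𝒪_𝔭R(G) + (1 - e)·𝒪_𝔭R(G)`. -/
def blockIdeal (𝒪 : Type*) (K : Type u) [CommRing 𝒪] [Field K] [Algebra 𝒪 K] (𝔭 : Ideal 𝒪)
    (G : Type u) [Group G] (e : locCharRing 𝒪 K 𝔭 G) : Ideal (locCharRing 𝒪 K 𝔭 G) :=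
  pConstIdeal 𝒪 K 𝔭 G ⊔ Ideal.span {1 - e}

/-- The block `kR_𝔭(G, C) = kR(G)·ē_C` of `kR(G)`, as a (unital) `k`-algebra, realized as the
quotient of `𝒪_𝔭R(G)` by `𝔭·𝒪_𝔭R(G) + (1 - e_C)·𝒪_𝔭R(G)`. -/
abbrev blockAlg (𝒪 : Type*) (K : Type u) [CommRing 𝒪] [Field K] [Algebra 𝒪 K] (𝔭 : Ideal 𝒪)
    (G : Type u) [Group G] (e : locCharRing 𝒪 K 𝔭 G) :=
  locCharRing 𝒪 K 𝔭 G ⧸ blockIdeal 𝒪 K 𝔭 G e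

/-- The constants, as a ring morphism `𝒪 →+* 𝒪_𝔭R(G)`. -/
noncomputable def constRingHom (𝒪 : Type*) (K : Type u) [CommRing 𝒪] [Field K] [Algebra 𝒪 K]
    (𝔭 : Ideal 𝒪) [𝔭.IsMaximal] (G : Type u) [Group G] : 𝒪 →+* locCharRing 𝒪 K 𝔭 G where
  toFun a := ⟨Function.const G (algebraMap 𝒪 K a),
    Subring.subset_closure (Or.inl ⟨algebraMap 𝒪 K a,
      ⟨a, 1, fun h => (Ideal.ne_top_iff_one 𝔭).mp (Ideal.IsMaximal.ne_top ‹_›) h, by simp⟩, rfl⟩)⟩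
  map_one' := Subtype.ext (funext fun g => by simp)
  map_mul' a b := Subtype.ext (funext fun g => by simp)
  map_zero' := Subtype.ext (funext fun g => by simp)
  map_add' a b := Subtype.ext (funext fun g => by simp)

/-- The structural morphism giving quotients of `𝒪_𝔭R(G)` by ideals containing
`𝔭·𝒪_𝔭R(G)` (such as `kR(G)` and its blocks) their `k = 𝒪/𝔭`-algebra structure. -/
noncomputable def kScalars (𝒪 : Type*) (K : Type u) [CommRing 𝒪] [Field K] [Algebra 𝒪 K]
    (𝔭 : Ideal 𝒪) [𝔭.IsMaximal] (G : Type u) [Group G]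
    (I : Ideal (locCharRing 𝒪 K 𝔭 G)) (hI : pConstIdeal 𝒪 K 𝔭 G ≤ I) :
    (𝒪 ⧸ 𝔭) →+* (locCharRing 𝒪 K 𝔭 G ⧸ I) :=
  Ideal.Quotient.lift 𝔭 ((Ideal.Quotient.mk I).comp (constRingHom 𝒪 K 𝔭 G))
    (fun a ha => by
      simp only [RingHom.comp_apply]
      exact Ideal.Quotient.eq_zero_iff_mem.mpr (hI (Ideal.subset_span ⟨a, ha, rfl⟩)))

/-- The `k`-algebra structure morphism of the block `kR_𝔭(G, C)`. -/
noncomputable def blockScalars (𝒪 : Type*) (K : Type u) [CommRing 𝒪] [Field K] [Algebra 𝒪 K]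
    (𝔭 : Ideal 𝒪) [𝔭.IsMaximal] (G : Type u) [Group G] (e : locCharRing 𝒪 K 𝔭 G) :
    (𝒪 ⧸ 𝔭) →+* blockAlg 𝒪 K 𝔭 G e :=
  kScalars 𝒪 K 𝔭 G (blockIdeal 𝒪 K 𝔭 G e) le_sup_left

/-- The Jacobson radical of a ring. -/
noncomputable def jacRad (A : Type*) [CommRing A] : Ideal A := (⊥ : Ideal A).jacobson

/-- The Loewy length of `A`: the least `n` with `(Rad A) ^ n = 0`. -/
noncomputable def loewyLength (A : Type*) [CommRing A] : ℕ :=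
  sInf {n : ℕ | jacRad A ^ n = ⊥}

/-- `Rad A / (Rad A)²`. -/
noncomputable abbrev radQuotient (A : Type*) [CommRing A] :=
  jacRad A ⧸ (Submodule.comap (jacRad A).subtype (jacRad A ^ 2 : Ideal A))

/-- `dim_k Rad(A)/Rad(A)²`, the `k`-vector space structure being induced by a ring morphism
`k →+* A`. -/
noncomputable def extDim (k : Type*) [CommRing k] {A : Type*} [CommRing A] (φ : k →+* A) : ℕ :=
  letI : Module k (radQuotient A) := Module.compHom _ φ
  Module.finrank k (radQuotient A)

/-- `dim_k A`, the `k`-vector space structure being induced by a ring morphism `k →+* A`. -/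
noncomputable def kDim (k : Type*) [CommRing k] {A : Type*} [CommRing A] (φ : k →+* A) : ℕ :=
  letI : Module k A := Module.compHom _ φ
  Module.finrank k A

/-- `dim_k I` for an ideal `I` of `A`, the `k`-vector space structure being induced by a ring
morphism `k →+* A`. -/
noncomputable def idealKDim (k : Type*) [CommRing k] {A : Type*} [CommRing A] (φ : k →+* A)
    (I : Ideal A) : ℕ :=
  letI : Module k I := Module.compHom _ φ
  Module.finrank k I

/-- A primitive idempotent of a ring: a nonzero idempotent which is not the sum of two nonzero
orthogonal idempotents. -/
def IsPrimitiveIdempotent {R : Type*} [Ring R] (e : R) : Prop :=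
  IsIdempotentElem e ∧ e ≠ 0 ∧
    ∀ a b : R, IsIdempotentElem a → IsIdempotentElem b → a * b = 0 → b * a = 0 →
      a + b = e → a = 0 ∨ b = 0

/-- An endomorphism `T` with `T ^ n = 1` is diagonalizable over a field of characteristic zero
containing a primitive `n`-th root of unity. -/
theorem isInternal_eigenspace_of_pow_eq_one {K V : Type*} [Field K] [CharZero K] [AddCommGroup V]
    [Module K V] {n : ℕ} (hn : n ≠ 0) {ζ : K} (hζ : IsPrimitiveRoot ζ n) (T : Module.End K V)
    (hT : T ^ n = 1) :
    DirectSum.IsInternal (fun j : Fin n => T.eigenspace (ζ ^ (j : ℕ))) := by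
  have hζ0 : ζ ≠ 0 := hζ.ne_zero hn
  apply DirectSum.isInternal_submodule_of_iSupIndep_of_iSup_eq_top
  · exact T.eigenspaces_iSupIndep.comp fun i j h => Fin.ext (hζ.pow_inj i.2 j.2 h)
  · rw [eq_top_iff]
    rintro v -
    let w : Fin n → V := fun j =>
      ∑ i ∈ Finset.range n, ((ζ ^ (j : ℕ))⁻¹) ^ i • (T ^ i) v
    have hw : ∀ j : Fin n, w j ∈ T.eigenspace (ζ ^ (j : ℕ)) := by
      intro j
      have hu : ζ ^ (j : ℕ) ≠ 0 := pow_ne_zero _ hζ0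
      have hun : ((ζ ^ (j : ℕ))⁻¹) ^ n = 1 := by
        rw [inv_pow, ← pow_mul, mul_comm, pow_mul, hζ.pow_eq_one, one_pow, inv_one]
      have hshift : ∑ i ∈ Finset.range n, ((ζ ^ (j : ℕ))⁻¹) ^ (i + 1) • (T ^ (i + 1)) v = w j := by
        have h1 := Finset.sum_range_succ (fun i => ((ζ ^ (j : ℕ))⁻¹) ^ i • (T ^ i) v) n
        rw [Finset.sum_range_succ', hun, hT, pow_zero, pow_zero] at h1
        exact add_right_cancel h1
      rw [Module.End.mem_eigenspace_iff]
      conv_rhs => rw [← hshift]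
      rw [map_sum, Finset.smul_sum]
      refine Finset.sum_congr rfl fun i _ => ?_
      rw [map_smul, smul_smul, pow_succ' _ i, mul_inv_cancel_left₀ hu, pow_succ' T i]
      rfl
    have hsum : ∑ j, w j = (n : K) • v := by
      simp only [w]
      rw [Finset.sum_comm, Finset.sum_eq_single_of_mem 0 (Finset.mem_range.2 hn.bot_lt)]
      · simp [Nat.cast_smul_eq_nsmul]
      · intro i hi hi0
        rw [← Finset.sum_smul]
        have hi1 : (ζ⁻¹) ^ i ≠ 1 := by
          rw [inv_pow, ne_eq, inv_eq_one]
          exact hζ.pow_ne_one_of_pos_of_lt hi0 (Finset.mem_range.1 hi)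
        have hgeom : ∑ j ∈ Finset.range n, ((ζ⁻¹) ^ i) ^ j = 0 := by
          have := mul_neg_geom_sum ((ζ⁻¹) ^ i) n
          rw [← pow_mul, mul_comm i n, pow_mul, inv_pow ζ n, hζ.pow_eq_one, inv_one, one_pow,
            sub_self] at this
          exact (mul_eq_zero.1 this).resolve_left (sub_ne_zero.2 (Ne.symm hi1))
        rw [Finset.sum_range] at hgeom
        have : ∑ j : Fin n, ((ζ ^ (j : ℕ))⁻¹) ^ i = 0 := by
          rw [← hgeom]
          refine Finset.sum_congr rfl fun j _ => ?_
          rw [← inv_pow, ← pow_mul, ← pow_mul, mul_comm]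
        rw [this, zero_smul]
    have hv : v = (n : K)⁻¹ • ∑ j, w j := by
      rw [hsum, smul_smul, inv_mul_cancel₀ (Nat.cast_ne_zero.2 hn), one_smul]
    rw [hv]
    exact Submodule.smul_mem _ _ (Submodule.sum_mem _ fun j _ =>
      Submodule.mem_iSup_of_mem j (hw j))

/-- If `S` commutes with `T`, then `S` preserves the eigenspaces of `T`. -/
theorem apply_mem_eigenspace_of_commute {K V : Type*} [Field K] [AddCommGroup V] [Module K V]
    {S T : Module.End K V} (h : Commute S T) (μ : K) :
    ∀ v ∈ T.eigenspace μ, S v ∈ T.eigenspace μ := by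
  intro v hv
  rw [Module.End.mem_eigenspace_iff] at hv ⊢
  rw [← Module.End.mul_apply, ← h.eq, Module.End.mul_apply, hv, map_smul]

theorem trace_mul_eq_sum_eigenspace {K V : Type*} [Field K] [CharZero K] [AddCommGroup V]
    [Module K V] [FiniteDimensional K V] {n : ℕ} (hn : n ≠ 0) {ζ : K} (hζ : IsPrimitiveRoot ζ n)
    (S T : Module.End K V) (hT : T ^ n = 1) (h : Commute S T) :
    LinearMap.trace K V (S * T) = ∑ j : Fin n, ζ ^ (j : ℕ) *
      LinearMap.trace K _ (S.restrict (apply_mem_eigenspace_of_commute h (ζ ^ (j : ℕ)))) := by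
  have hST : Commute (S * T) T := h.mul_left rfl
  rw [LinearMap.trace_eq_sum_trace_restrict (isInternal_eigenspace_of_pow_eq_one hn hζ T hT)
    fun j => apply_mem_eigenspace_of_commute hST _]
  refine Finset.sum_congr rfl fun j _ => ?_
  rw [← smul_eq_mul (ζ ^ (j : ℕ)), ← map_smul]
  congr 1
  ext ⟨v, hv⟩
  change S (T v) = _ • S v
  rw [Module.End.mem_eigenspace_iff.1 hv, map_smul]

theorem trace_pow_eq_sum_eigenspace {K V : Type*} [Field K] [CharZero K] [AddCommGroup V]
    [Module K V] [FiniteDimensional K V] {n : ℕ} (hn : n ≠ 0) {ζ : K} (hζ : IsPrimitiveRoot ζ n)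
    (T : Module.End K V) (hT : T ^ n = 1) (q : ℕ) :
    LinearMap.trace K V (T ^ q) = ∑ j : Fin n, (ζ ^ (j : ℕ)) ^ q *
      (Module.finrank K (T.eigenspace (ζ ^ (j : ℕ))) : K) := by
  have hST : Commute (T ^ q) T := (Commute.refl T).pow_left q
  rw [LinearMap.trace_eq_sum_trace_restrict (isInternal_eigenspace_of_pow_eq_one hn hζ T hT)
    fun j => apply_mem_eigenspace_of_commute hST _]
  refine Finset.sum_congr rfl fun j _ => ?_
  rw [← LinearMap.trace_id, ← smul_eq_mul, ← map_smul]
  congr 1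
  ext ⟨v, hv⟩
  have : ∀ q : ℕ, (T ^ q) v = (ζ ^ (j : ℕ)) ^ q • v := by
    intro q
    induction q with
    | zero => simp
    | succ q ih =>
      rw [Module.End.mem_eigenspace_iff] at hv
      rw [pow_succ' T, Module.End.mul_apply, ih, map_smul, hv, smul_smul, pow_succ]
  exact this q

/-- The twisted character `y ↦ tr (ρ y ∘ T)` attached to a finite order automorphism `T` of a
representation is a linear combination of characters with coefficients in `𝒪_𝔭`. -/
theorem trace_mul_mem_locCharRing {𝒪 : Type*} [CommRing 𝒪] [IsDedekindDomain 𝒪]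
    {K : Type u} [Field K] [CharZero K] [Algebra 𝒪 K] [IsFractionRing 𝒪 K] {𝔭 : Ideal 𝒪}
    (h𝔭 : 𝔭 ≠ ⊤) {G : Type u} [Group G] {n : ℕ} (hn : n ≠ 0) {ζ : K} (hζ : IsPrimitiveRoot ζ n)
    {V : Type u} [AddCommGroup V] [Module K V] [FiniteDimensional K V] (ρ : Representation K G V)
    (T : Module.End K V) (hT : T ^ n = 1) (h : ∀ y, Commute (ρ y) T) :
    (fun y => LinearMap.trace K V (ρ y * T)) ∈ locCharRing 𝒪 K 𝔭 G := by
  obtain ⟨ζ₀, rfl⟩ := IsIntegrallyClosed.algebraMap_eq_of_integral (R := 𝒪)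
    (IsIntegral.of_pow hn.bot_lt (by rw [hζ.pow_eq_one]; exact isIntegral_one))
  let σ (j : Fin n) : Representation K G (T.eigenspace (algebraMap 𝒪 K ζ₀ ^ (j : ℕ))) :=
    { toFun y := (ρ y).restrict (apply_mem_eigenspace_of_commute (h y) _)
      map_one' := by ext; simp
      map_mul' x y := by ext; simp }
  have : (fun y => LinearMap.trace K V (ρ y * T)) = ∑ j : Fin n,
      Function.const G (algebraMap 𝒪 K (ζ₀ ^ (j : ℕ))) * (FDRep.of (σ j)).character := by
    funext y
    rw [trace_mul_eq_sum_eigenspace hn hζ _ _ hT (h y), Finset.sum_apply]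
    refine Finset.sum_congr rfl fun j _ => ?_
    rw [Pi.mul_apply, Function.const_apply, map_pow]
    rfl
  rw [this]
  refine Subring.sum_mem _ fun j _ => Subring.mul_mem _
    (Subring.subset_closure (Or.inl ⟨_, ?_, rfl⟩)) (Subring.subset_closure (Or.inr ⟨_, rfl⟩))
  exact ⟨ζ₀ ^ (j : ℕ), 1, (Ideal.ne_top_iff_one 𝔭).1 h𝔭, by simp⟩

theorem card_smul_eq_mem_locCharRing {𝒪 : Type*} [CommRing 𝒪] [IsDedekindDomain 𝒪]
    {K : Type u} [Field K] [CharZero K] [Algebra 𝒪 K] [IsFractionRing 𝒪 K] {𝔭 : Ideal 𝒪}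
    (h𝔭 : 𝔭 ≠ ⊤) {G : Type u} [Group G] {n : ℕ} (hn : n ≠ 0) {ζ : K} (hζ : IsPrimitiveRoot ζ n)
    {X : Type u} [Finite X] [MulAction G X] (τ : X → X) (hτ : τ^[n] = id)
    (h : ∀ (y : G) c, τ (y • c) = y • τ c) :
    (fun y : G => ((Nat.card {c : X // y • c = τ c} : ℕ) : K)) ∈ locCharRing 𝒪 K 𝔭 G := by
  have := Fintype.ofFinite X
  let ρ : Representation K G (X → K) :=
    { toFun y := LinearMap.funLeft K K (fun c => y⁻¹ • c)
      map_one' := by ext; simp [LinearMap.funLeft]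
      map_mul' x y := by ext; simp [LinearMap.funLeft, mul_smul] }
  let T : Module.End K (X → K) := LinearMap.funLeft K K τ
  have hTk : ∀ (k : ℕ) (f : X → K), (T ^ k) f = f ∘ τ^[k] := by
    intro k
    induction k with
    | zero => intro f; simp
    | succ k ih =>
      intro f
      rw [pow_succ, Module.End.mul_apply, ih, Function.iterate_succ']
      rfl
  have hT : T ^ n = 1 := by
    ext1
    ext1
    simp [hTk, hτ]
  have hc : ∀ y, Commute (ρ y) T := by
    intro y
    refine LinearMap.ext fun f => funext fun c => ?_
    change f (τ (y⁻¹ • c)) = f (y⁻¹ • τ c)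
    rw [h]
  convert! trace_mul_mem_locCharRing (𝒪 := 𝒪) h𝔭 hn hζ ρ T hT hc using 2 with y
  rw [LinearMap.trace_eq_matrix_trace K (Pi.basisFun K X), Matrix.trace]
  rw [Nat.card_eq_fintype_card, Fintype.card_subtype, Finset.natCast_card_filter]
  refine Finset.sum_congr rfl fun c _ => ?_
  rw [Matrix.diag_apply, LinearMap.toMatrix_apply, Pi.basisFun_repr, Pi.basisFun_apply]
  change _ = (Pi.single c (1 : K) : X → K) (τ (y⁻¹ • c))
  rw [Pi.single_apply, h, inv_smul_eq_iff]
  simp only [eq_comm]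

/-- `g` and its `p'`-part have the same `q`-th power, `q` being the `p`-part of the order. -/
theorem pPrimePart_pow_eq (p : ℕ) [hp : Fact p.Prime] {G : Type*} [Group G] [Finite G] (g : G) :
    pPrimePart p g ^ p ^ (orderOf g).factorization p = g ^ p ^ (orderOf g).factorization p := by
  have ho : orderOf g ≠ 0 := (orderOf_pos g).ne'
  unfold pPrimePart
  set q := p ^ (orderOf g).factorization p with hq
  set m := orderOf g / q
  have hmq : q * m = orderOf g := Nat.ordProj_mul_ordCompl_eq_self _ _
  have hm0 : NeZero m := ⟨fun h => ho (by rw [← hmq, h, mul_zero])⟩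
  have hcop : q.Coprime m := (Nat.coprime_ordCompl hp.out ho).pow_left _
  have h1 : q * (((p : ZMod m) ^ (orderOf g).factorization p)⁻¹).val ≡ 1 [MOD m] := by
    rw [← ZMod.natCast_eq_natCast_iff]
    have := ZMod.coe_mul_inv_eq_one q hcop
    rw [Nat.cast_mul, ZMod.natCast_zmod_val, Nat.cast_one, ← this, hq, Nat.cast_pow]
  have := h1.mul_left' q
  rw [mul_one, hmq] at this
  rw [← pow_mul, pow_eq_pow_iff_modEq, mul_comm]
  exact this

theorem pPrimePart_isPRegular (p : ℕ) [hp : Fact p.Prime] {G : Type*} [Group G] [Finite G]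
    (g : G) : IsPRegular p (pPrimePart p g) := by
  have ho : orderOf g ≠ 0 := (orderOf_pos g).ne'
  refine Nat.Coprime.coprime_dvd_left (orderOf_dvd_of_pow_eq_one ?_)
    (Nat.coprime_ordCompl hp.out ho).symm
  unfold pPrimePart
  rw [mul_comm, ← pow_mul, mul_assoc, Nat.ordProj_mul_ordCompl_eq_self, mul_comm, pow_mul,
    pow_orderOf_eq_one, one_pow]

theorem pPrimePart_conj (p : ℕ) {G : Type*} [Group G] (h g : G) :
    pPrimePart p (h * g * h⁻¹) = h * pPrimePart p g * h⁻¹ := by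
  have ho : orderOf (h * g * h⁻¹) = orderOf g := (MulAut.conj h).orderOf_eq g
  unfold pPrimePart
  rw [ho, conj_pow]

theorem pPrimePart_mul_of_commute (p : ℕ) [hp : Fact p.Prime] {G : Type*} [Group G] [Finite G]
    {x u : G} (hx : IsPRegular p x) (h : Commute x u) {k : ℕ} (hu : orderOf u = p ^ k) :
    pPrimePart p (x * u) = x := by
  set s := pPrimePart p (x * u) with hs
  have hcop : (orderOf x).Coprime (orderOf u) := by
    rw [hu]
    exact Nat.Coprime.pow_right _ hx
  have ho : orderOf (x * u) = orderOf x * p ^ k := by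
    rw [h.orderOf_mul_eq_mul_orderOf_of_coprime hcop, hu]
  have hx0 : orderOf x ≠ 0 := (orderOf_pos x).ne'
  have hfac : (orderOf (x * u)).factorization p = k := by
    rw [ho, Nat.factorization_mul hx0 (pow_ne_zero _ hp.out.ne_zero), Finsupp.add_apply,
      hp.out.factorization_pow, Finsupp.single_eq_same,
      Nat.factorization_eq_zero_of_not_dvd ((hp.out.coprime_iff_not_dvd).1 hx.symm), zero_add]
  have hq : s ^ p ^ k = x ^ p ^ k := by
    have := pPrimePart_pow_eq p (x * u)
    rwa [hfac, h.mul_pow, ← hu, pow_orderOf_eq_one, mul_one, hu] at this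
  have hsx : Commute s x := ((Commute.refl x).mul_left h.symm).pow_left _
  have h1 : orderOf (s * x⁻¹) ∣ p ^ k := by
    apply orderOf_dvd_of_pow_eq_one
    rw [hsx.inv_right.mul_pow, hq, inv_pow, mul_inv_cancel]
  have h2 : orderOf (s * x⁻¹) ∣ orderOf s * orderOf x := by
    refine hsx.inv_right.orderOf_mul_dvd_mul_orderOf.trans ?_
    rw [orderOf_inv]
  have h3 : (orderOf s * orderOf x).Coprime (p ^ k) :=
    Nat.Coprime.pow_right _ (Nat.Coprime.mul_left (pPrimePart_isPRegular p _) hx)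
  rw [← mul_inv_eq_one, ← orderOf_eq_one_iff]
  exact Nat.eq_one_of_dvd_coprimes h3 h2 h1

theorem pPrimePart_eq_self (p : ℕ) [hp : Fact p.Prime] {G : Type*} [Group G] [Finite G]
    {x : G} (hx : IsPRegular p x) : pPrimePart p x = x := by
  simpa using pPrimePart_mul_of_commute p hx (Commute.one_right x) (k := 0) (by simp)

/-- The values of a character at `y` and at the `p'`-part of `y` are congruent modulo `𝔭`. -/
theorem exists_character_eq_sub_mem {𝒪 : Type*} [CommRing 𝒪] [IsDedekindDomain 𝒪]
    {K : Type u} [Field K] [CharZero K] [Algebra 𝒪 K] [IsFractionRing 𝒪 K] {𝔭 : Ideal 𝒪}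
    [𝔭.IsMaximal] (p : ℕ) [hp : Fact p.Prime] (hp𝔭 : (p : 𝒪) ∈ 𝔭) {G : Type u} [Group G] [Finite G]
    {ζ : K} (hζ : IsPrimitiveRoot ζ (Nat.card G)) (V : FDRep K G) (y : G) :
    ∃ a b : 𝒪, V.character y = algebraMap 𝒪 K a ∧
      V.character (pPrimePart p y) = algebraMap 𝒪 K b ∧ a - b ∈ 𝔭 := by
  have hn : Nat.card G ≠ 0 := Nat.card_pos.ne'
  obtain ⟨ζ₀, rfl⟩ := IsIntegrallyClosed.algebraMap_eq_of_integral (R := 𝒪)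
    (IsIntegral.of_pow hn.bot_lt (by rw [hζ.pow_eq_one]; exact isIntegral_one))
  have : CharP (𝒪 ⧸ 𝔭) p := by
    refine ringChar.of_eq (CharP.ringChar_of_prime_eq_zero hp.out ?_)
    rw [← map_natCast (Ideal.Quotient.mk 𝔭), Ideal.Quotient.eq_zero_iff_mem]
    exact hp𝔭
  have key : ∀ z : G, ∃ d : Fin (Nat.card G) → ℕ, ∀ q, V.character (z ^ q) =
      algebraMap 𝒪 K (∑ j : Fin (Nat.card G), (ζ₀ ^ (j : ℕ)) ^ q * (d j : 𝒪)) := by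
    intro z
    refine ⟨fun j => Module.finrank K
      (Module.End.eigenspace (V.ρ z) (algebraMap 𝒪 K ζ₀ ^ (j : ℕ))), fun q => ?_⟩
    have h := trace_pow_eq_sum_eigenspace hn hζ (V.ρ z)
      (by rw [← map_pow, pow_card_eq_one', map_one]) q
    rw [FDRep.character, map_pow, h]
    simp
  have frob : ∀ (z : G), ∃ a : 𝒪, V.character z = algebraMap 𝒪 K a ∧ ∀ k, ∃ b : 𝒪,
      V.character (z ^ p ^ k) = algebraMap 𝒪 K b ∧
      (Ideal.Quotient.mk 𝔭 a) ^ p ^ k = Ideal.Quotient.mk 𝔭 b := by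
    intro z
    obtain ⟨d, hd⟩ := key z
    refine ⟨_, by rw [← hd 1, pow_one], fun k => ⟨_, hd _, ?_⟩⟩
    simp only [pow_one]
    rw [map_sum, map_sum, sum_pow_char_pow]
    refine Finset.sum_congr rfl fun j _ => ?_
    rw [map_mul, map_mul, mul_pow, map_pow _ _ (p ^ k), map_natCast]
    congr 1
    rw [← iterateFrobenius_def, map_natCast]
  obtain ⟨a, ha, ha'⟩ := frob y
  obtain ⟨b, hb, hb'⟩ := frob (pPrimePart p y)
  refine ⟨a, b, ha, hb, ?_⟩
  obtain ⟨a', ha1, ha2⟩ := ha' ((orderOf y).factorization p)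
  obtain ⟨b', hb1, hb2⟩ := hb' ((orderOf y).factorization p)
  rw [pPrimePart_pow_eq, ha1] at hb1
  have hab := IsFractionRing.injective 𝒪 K hb1
  rw [← Ideal.Quotient.eq]
  apply iterateFrobenius_inj (𝒪 ⧸ 𝔭) p ((orderOf y).factorization p)
  rw [iterateFrobenius_def, iterateFrobenius_def, ha2, hb2, hab]

/-- Elements of `𝒪_𝔭R(G)` are class functions. -/
theorem apply_conj_of_mem_locCharRing {𝒪 : Type*} [CommRing 𝒪] {K : Type u} [Field K]
    [Algebra 𝒪 K] {𝔭 : Ideal 𝒪} {G : Type u} [Group G] {f : G → K}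
    (hf : f ∈ locCharRing 𝒪 K 𝔭 G) (h g : G) : f (h * g * h⁻¹) = f g := by
  induction hf using Subring.closure_induction with
  | mem f hf =>
    obtain ⟨x, -, rfl⟩ | ⟨V, rfl⟩ := hf
    · rfl
    · exact V.char_conj g h
  | zero => rfl
  | one => rfl
  | add f f' _ _ h1 h2 => simp only [Pi.add_apply, h1, h2]
  | neg f _ h1 => simp only [Pi.neg_apply, h1]
  | mul f f' _ _ h1 h2 => simp only [Pi.mul_apply, h1, h2]

theorem apply_eq_of_isConj_of_mem_locCharRing {𝒪 : Type*} [CommRing 𝒪] {K : Type u} [Field K]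
    [Algebra 𝒪 K] {𝔭 : Ideal 𝒪} {G : Type u} [Group G] {f : G → K}
    (hf : f ∈ locCharRing 𝒪 K 𝔭 G) {g g' : G} (h : IsConj g g') : f g = f g' := by
  obtain ⟨c, rfl⟩ := isConj_iff.1 h
  exact (apply_conj_of_mem_locCharRing hf c g).symm

/-- The values of an element of `𝒪_𝔭R(G)` at `y` and at the `p'`-part of `y` are congruent
modulo `𝔭𝒪_𝔭`. -/
theorem exists_mul_eq_sub_mem_of_mem_locCharRing {𝒪 : Type*} [CommRing 𝒪] [IsDedekindDomain 𝒪]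
    {K : Type u} [Field K] [CharZero K] [Algebra 𝒪 K] [IsFractionRing 𝒪 K] {𝔭 : Ideal 𝒪}
    [𝔭.IsMaximal] (p : ℕ) [Fact p.Prime] (hp𝔭 : (p : 𝒪) ∈ 𝔭) {G : Type u} [Group G] [Finite G]
    {ζ : K} (hζ : IsPrimitiveRoot ζ (Nat.card G)) {f : G → K}
    (hf : f ∈ locCharRing 𝒪 K 𝔭 G) (y : G) :
    ∃ a b d : 𝒪, d ∉ 𝔭 ∧ f y * algebraMap 𝒪 K d = algebraMap 𝒪 K a ∧
      f (pPrimePart p y) * algebraMap 𝒪 K d = algebraMap 𝒪 K b ∧ a - b ∈ 𝔭 := by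
  have h𝔭 : (1 : 𝒪) ∉ 𝔭 := (Ideal.ne_top_iff_one 𝔭).1 (Ideal.IsMaximal.ne_top ‹_›)
  have hprime : 𝔭.IsPrime := Ideal.IsMaximal.isPrime ‹_›
  have hmul : ∀ d d' : 𝒪, d ∉ 𝔭 → d' ∉ 𝔭 → d * d' ∉ 𝔭 := fun d d' h h' hd =>
    (hprime.mem_or_mem hd).elim h h'
  induction hf using Subring.closure_induction with
  | mem f hf =>
    obtain ⟨x, ⟨a, d, hd, hx⟩, rfl⟩ | ⟨V, rfl⟩ := hf
    · exact ⟨a, a, d, hd, hx, hx, by simp⟩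
    · obtain ⟨a, b, ha, hb, hab⟩ := exists_character_eq_sub_mem p hp𝔭 hζ V y
      exact ⟨a, b, 1, h𝔭, by simp [ha], by simp [hb], hab⟩
  | zero => exact ⟨0, 0, 1, h𝔭, by simp, by simp, by simp⟩
  | one => exact ⟨1, 1, 1, h𝔭, by simp, by simp, by simp⟩
  | add f f' _ _ h1 h2 =>
    obtain ⟨a, b, d, hd, ha, hb, hab⟩ := h1
    obtain ⟨a', b', d', hd', ha', hb', hab'⟩ := h2
    refine ⟨a * d' + a' * d, b * d' + b' * d, d * d', hmul _ _ hd hd', ?_, ?_, ?_⟩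
    · simp only [map_add, map_mul, ← ha, ← ha', Pi.add_apply]
      ring
    · simp only [map_add, map_mul, ← hb, ← hb', Pi.add_apply]
      ring
    · convert 𝔭.add_mem (𝔭.mul_mem_left d' hab) (𝔭.mul_mem_left d hab') using 1
      ring
  | neg f _ h1 =>
    obtain ⟨a, b, d, hd, ha, hb, hab⟩ := h1
    refine ⟨-a, -b, d, hd, by simp [ha], by simp [hb], ?_⟩
    convert 𝔭.neg_mem hab using 1
    ring
  | mul f f' _ _ h1 h2 =>
    obtain ⟨a, b, d, hd, ha, hb, hab⟩ := h1
    obtain ⟨a', b', d', hd', ha', hb', hab'⟩ := h2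
    refine ⟨a * a', b * b', d * d', hmul _ _ hd hd', ?_, ?_, ?_⟩
    · simp only [map_mul, ← ha, ← ha', Pi.mul_apply]
      ring
    · simp only [map_mul, ← hb, ← hb', Pi.mul_apply]
      ring
    · convert 𝔭.add_mem (𝔭.mul_mem_left a hab') (𝔭.mul_mem_left b' hab) using 1
      ring

/-- A class function all of whose values are divisible by `|G|` in `𝒪_𝔭` lies in `𝒪_𝔭R(G)`. -/
theorem mem_locCharRing_of_card_dvd {𝒪 : Type*} [CommRing 𝒪] [IsDedekindDomain 𝒪]
    {K : Type u} [Field K] [CharZero K] [Algebra 𝒪 K] [IsFractionRing 𝒪 K] {𝔭 : Ideal 𝒪}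
    (h𝔭 : 𝔭 ≠ ⊤) {G : Type u} [Group G] [Finite G]
    {ζ : K} (hζ : IsPrimitiveRoot ζ (Nat.card G)) {f : G → K}
    (hf : ∀ h g, f (h * g * h⁻¹) = f g) (hdvd : ∀ g, f g / (Nat.card G : K) ∈ locSet 𝒪 K 𝔭) :
    f ∈ locCharRing 𝒪 K 𝔭 G := by
  have := Fintype.ofFinite G
  have hn : Nat.card G ≠ 0 := Nat.card_pos.ne'
  have hind (g : G) : (fun y : G => ((Nat.card {c : G // y • c = c * g} : ℕ) : K)) ∈
      locCharRing 𝒪 K 𝔭 G := by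
    refine card_smul_eq_mem_locCharRing h𝔭 hn hζ (fun c => c * g) ?_
      fun y c => by simp [mul_assoc]
    rw [mul_right_iterate, pow_card_eq_one']
    exact funext mul_one
  have : f = ∑ g, Function.const G (f g / (Nat.card G : K)) *
      fun y : G => ((Nat.card {c : G // y • c = c * g} : ℕ) : K) := by
    funext y
    have hcard (g : G) : ((Nat.card {c : G // y • c = c * g} : ℕ) : K) =
        ∑ c : G, if c⁻¹ * y * c = g then 1 else 0 := by
      rw [Nat.card_eq_fintype_card, Fintype.card_subtype, Finset.natCast_card_filter]
      refine Finset.sum_congr rfl fun c _ => ?_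
      rw [smul_eq_mul, mul_assoc, inv_mul_eq_iff_eq_mul]
    simp only [Finset.sum_apply, Pi.mul_apply, Function.const_apply, hcard, Finset.mul_sum]
    rw [Finset.sum_comm]
    have hfc (c : G) : f (c⁻¹ * y * c) = f y := by simpa using hf c⁻¹ y
    simp only [mul_ite, mul_one, mul_zero, Finset.sum_ite_eq, Finset.mem_univ, if_true, hfc,
      Finset.sum_const, Finset.card_univ, ← Nat.card_eq_fintype_card, nsmul_eq_mul]
    rw [mul_div_cancel₀ _ (Nat.cast_ne_zero.2 hn)]
  rw [this]
  exact Subring.sum_mem _ fun g _ => Subring.mul_mem _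
    (Subring.subset_closure (Or.inl ⟨_, hdvd g, rfl⟩)) (hind g)

theorem natCast_notMem_of_not_dvd {𝒪 : Type*} [CommRing 𝒪] {𝔭 : Ideal 𝒪} (h𝔭 : 𝔭 ≠ ⊤) {p : ℕ}
    (hp : p.Prime) (hp𝔭 : (p : 𝒪) ∈ 𝔭) {n : ℕ} (hn : ¬ p ∣ n) : (n : 𝒪) ∉ 𝔭 := by
  intro h
  have hcop : IsCoprime (p : ℤ) (n : ℤ) :=
    Nat.isCoprime_iff_coprime.2 ((hp.coprime_iff_not_dvd).2 hn)
  obtain ⟨a, b, hab⟩ := hcop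
  apply (Ideal.ne_top_iff_one 𝔭).1 h𝔭
  have h1 : (a : 𝒪) * p + b * n = 1 := by exact_mod_cast congrArg (Int.cast : ℤ → 𝒪) hab
  rw [← h1]
  exact 𝔭.add_mem (𝔭.mul_mem_left _ hp𝔭) (𝔭.mul_mem_left _ h)

/-- For a `p`-regular element `x`, there is an `ℕ`-valued function in `𝒪_𝔭R(G)` supported on the
`p'`-section of `x` whose value at `x` is prime to `p`. -/
theorem exists_nat_mem_locCharRing {𝒪 : Type*} [CommRing 𝒪] [IsDedekindDomain 𝒪]
    {K : Type u} [Field K] [CharZero K] [Algebra 𝒪 K] [IsFractionRing 𝒪 K] {𝔭 : Ideal 𝒪}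
    (h𝔭 : 𝔭 ≠ ⊤) (p : ℕ) [Fact p.Prime] {G : Type u} [Group G] [Finite G]
    {ζ : K} (hζ : IsPrimitiveRoot ζ (Nat.card G)) {x : G} (hx : IsPRegular p x) :
    ∃ F : G → ℕ, (fun y => (F y : K)) ∈ locCharRing 𝒪 K 𝔭 G ∧
      (∀ y, F y ≠ 0 → IsConj x (pPrimePart p y)) ∧ ¬ p ∣ F x := by
  let Z : Subgroup G := Subgroup.centralizer {x}
  let P : Sylow p Z := default
  let Q : Subgroup G := (P : Subgroup Z).map Z.subtype
  have hQc : ∀ u ∈ Q, Commute x u := by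
    rintro _ ⟨u, -, rfl⟩
    exact (Subgroup.mem_centralizer_singleton_iff.1 u.2).symm
  have hQp : IsPGroup p Q := P.isPGroup'.map _
  let τ : G ⧸ Q → G ⧸ Q := Quotient.map' (fun g => g * x) fun a b hab => by
    rw [QuotientGroup.leftRel_apply] at hab ⊢
    have h1 : (a * x)⁻¹ * (b * x) = a⁻¹ * b := by
      have := (hQc _ hab).eq
      calc (a * x)⁻¹ * (b * x) = x⁻¹ * ((a⁻¹ * b) * x) := by group
        _ = a⁻¹ * b := by rw [← this, inv_mul_cancel_left]
    rwa [h1]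
  have hτ (g : G) : τ (g : G ⧸ Q) = ((g * x : G) : G ⧸ Q) := rfl
  have hτk (k : ℕ) (g : G) : τ^[k] (g : G ⧸ Q) = ((g * x ^ k : G) : G ⧸ Q) := by
    induction k with
    | zero => simp
    | succ k ih => rw [Function.iterate_succ_apply', ih, hτ, mul_assoc, pow_succ]
  have hfix {y g : G} (h : y • (g : G ⧸ Q) = τ g) : pPrimePart p y = g * x * g⁻¹ := by
    rw [hτ, MulAction.Quotient.smul_coe, QuotientGroup.eq, smul_eq_mul] at h
    obtain ⟨k, hk⟩ := (IsPGroup.iff_orderOf.1 hQp) ⟨_, h⟩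
    have hy : y = g * (x * ((y * g)⁻¹ * (g * x))⁻¹) * g⁻¹ := by group
    rw [hy, pPrimePart_conj, pPrimePart_mul_of_commute p hx (hQc _ h).inv_right (k := k)]
    rw [orderOf_inv, ← hk, Subgroup.orderOf_mk]
  refine ⟨fun y => Nat.card {c : G ⧸ Q // y • c = τ c},
    card_smul_eq_mem_locCharRing h𝔭 Nat.card_pos.ne' hζ τ ?_ ?_, ?_, ?_⟩
  · funext c
    induction c using QuotientGroup.induction_on with
    | H g => rw [hτk, pow_card_eq_one', mul_one, id]
  · intro y c
    induction c using QuotientGroup.induction_on with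
    | H g => rw [hτ, MulAction.Quotient.smul_coe, hτ, MulAction.Quotient.smul_coe, smul_eq_mul,
        smul_eq_mul, mul_assoc]
  · intro y hy
    obtain ⟨⟨c, hc⟩⟩ := (Nat.card_ne_zero.1 hy).1
    induction c using QuotientGroup.induction_on with
    | H g => exact isConj_iff.2 ⟨g, (hfix hc).symm⟩
  · have hZ : (QuotientGroup.mk ⁻¹' {c : G ⧸ Q | x • c = τ c} : Set G) = (Z : Set G) := by
      ext g
      rw [Set.mem_preimage, Set.mem_ofPred_eq, SetLike.mem_coe,
        Subgroup.mem_centralizer_singleton_iff]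
      constructor
      · intro h
        have := hfix h
        rw [pPrimePart_eq_self p hx] at this
        exact (eq_mul_inv_iff_mul_eq.1 this).symm
      · intro h
        rw [hτ, MulAction.Quotient.smul_coe, smul_eq_mul, h]
    have hcard := Nat.card_congr
      (QuotientGroup.preimageMkEquivSubgroupProdSet Q {c : G ⧸ Q | x • c = τ c})
    rw [hZ, Nat.card_prod] at hcard
    have hQ : Nat.card Q = Nat.card P :=
      Nat.card_congr ((P : Subgroup Z).equivMapOfInjective _ Z.subtype_injective).symm.toEquiv
    have hidx : Nat.card P * (P : Subgroup Z).index = Nat.card Z :=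
      (P : Subgroup Z).card_mul_index
    have hA : Nat.card {c : G ⧸ Q // x • c = τ c} = (P : Subgroup Z).index := by
      apply Nat.eq_of_mul_eq_mul_left (Nat.card_pos (α := P))
      rw [hidx, ← hQ]
      exact hcard.symm
    beta_reduce
    rw [hA]
    exact P.not_dvd_index

theorem eFun_mem_locCharRing {𝒪 : Type*} [CommRing 𝒪] [IsDedekindDomain 𝒪]
    {K : Type u} [Field K] [CharZero K] [Algebra 𝒪 K] [IsFractionRing 𝒪 K] {𝔭 : Ideal 𝒪}
    [𝔭.IsMaximal] (p : ℕ) [hp : Fact p.Prime] (hp𝔭 : (p : 𝒪) ∈ 𝔭) {G : Type u} [Group G] [Finite G]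
    {ζ : K} (hζ : IsPrimitiveRoot ζ (Nat.card G)) {x : G} (hx : IsPRegular p x) :
    eFun p K x ∈ locCharRing 𝒪 K 𝔭 G := by
  have h𝔭 : 𝔭 ≠ ⊤ := Ideal.IsMaximal.ne_top ‹_›
  have hprime : 𝔭.IsPrime := Ideal.IsMaximal.isPrime ‹_›
  have hinj := IsFractionRing.injective 𝒪 K
  have hn : Nat.card G ≠ 0 := Nat.card_pos.ne'
  obtain ⟨F, hF, hsupp, hFx⟩ := exists_nat_mem_locCharRing h𝔭 p hζ hx
  have hFy : ∀ y, IsConj x (pPrimePart p y) → ¬ p ∣ F y := by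
    intro y hy hdvd
    obtain ⟨a, b, d, hd, ha, hb, hab⟩ := exists_mul_eq_sub_mem_of_mem_locCharRing p hp𝔭 hζ hF y
    rw [← apply_eq_of_isConj_of_mem_locCharRing hF hy] at hb
    have ha' : (F y : 𝒪) * d = a := hinj (by rw [← ha, map_mul, map_natCast])
    have hb' : (F x : 𝒪) * d = b := hinj (by rw [← hb, map_mul, map_natCast])
    have ha𝔭 : a ∈ 𝔭 := by
      obtain ⟨k, hk⟩ := hdvd
      rw [← ha', hk, Nat.cast_mul]
      exact 𝔭.mul_mem_right _ (𝔭.mul_mem_right _ hp𝔭)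
    have hb𝔭 : b ∈ 𝔭 := by simpa using 𝔭.sub_mem ha𝔭 hab
    rw [← hb'] at hb𝔭
    exact (hprime.mem_or_mem hb𝔭).elim (natCast_notMem_of_not_dvd h𝔭 hp.out hp𝔭 hFx) hd
  set q := p ^ (Nat.card G).factorization p
  set l := Nat.card G / q
  have hql : q * l = Nat.card G := Nat.ordProj_mul_ordCompl_eq_self _ _
  have hl𝔭 : (l : 𝒪) ∉ 𝔭 := natCast_notMem_of_not_dvd h𝔭 hp.out hp𝔭
    ((hp.out.coprime_iff_not_dvd).1 (Nat.coprime_ordCompl hp.out hn))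
  have hq0 : q ≠ 0 := pow_ne_zero _ hp.out.ne_zero
  have hM : q.totient ≠ 0 := (Nat.totient_pos.2 hq0.bot_lt).ne'
  have hFM : (fun y => (F y : K)) ^ q.totient ∈ locCharRing 𝒪 K 𝔭 G := Subring.pow_mem _ hF _
  have hdiff : eFun p K x - (fun y => (F y : K)) ^ q.totient ∈ locCharRing 𝒪 K 𝔭 G := by
    refine mem_locCharRing_of_card_dvd h𝔭 hζ ?_ ?_
    · intro h g
      rw [Pi.sub_apply, Pi.sub_apply, apply_conj_of_mem_locCharRing hFM]
      have : IsConj x (pPrimePart p (h * g * h⁻¹)) ↔ IsConj x (pPrimePart p g) := by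
        have hc : IsConj (pPrimePart p g) (pPrimePart p (h * g * h⁻¹)) :=
          isConj_iff.2 ⟨h, (pPrimePart_conj p h g).symm⟩
        exact ⟨fun h' => h'.trans hc.symm, fun h' => h'.trans hc⟩
      simp only [eFun, this]
    · intro y
      rw [Pi.sub_apply, Pi.pow_apply, eFun]
      by_cases hy : IsConj x (pPrimePart p y)
      · have hcop : (F y).Coprime q :=
          (((hp.out.coprime_iff_not_dvd).2 (hFy y hy)).pow_left _).symm
        obtain ⟨k, hk⟩ := (Nat.modEq_iff_dvd.1 (Nat.ModEq.pow_totient hcop))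
        have hk' : (1 : K) - (F y : K) ^ q.totient = q * k := by
          exact_mod_cast congrArg (Int.cast : ℤ → K) hk
        refine ⟨k, l, hl𝔭, ?_⟩
        have hl0 : (l : K) ≠ 0 := Nat.cast_ne_zero.2 fun h => hn (by rw [← hql, h, mul_zero])
        have hqK : (q : K) ≠ 0 := Nat.cast_ne_zero.2 hq0
        rw [if_pos hy, hk', ← hql, map_natCast, map_intCast, Nat.cast_mul]
        field_simp
      · have : F y = 0 := by_contra fun h => hy (hsupp y h)
        refine ⟨0, 1, (Ideal.ne_top_iff_one 𝔭).1 h𝔭, ?_⟩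
        rw [if_neg hy]
        simp [this, hM]
  simpa using Subring.add_mem _ hdiff hFM

/-- An idempotent of `𝒪_𝔭R(G)` takes the same value at `y` and at the `p'`-part of `y`. -/
theorem apply_pPrimePart_of_isIdempotentElem {𝒪 : Type*} [CommRing 𝒪] [IsDedekindDomain 𝒪]
    {K : Type u} [Field K] [CharZero K] [Algebra 𝒪 K] [IsFractionRing 𝒪 K] {𝔭 : Ideal 𝒪}
    [𝔭.IsMaximal] (p : ℕ) [Fact p.Prime] (hp𝔭 : (p : 𝒪) ∈ 𝔭) {G : Type u} [Group G] [Finite G]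
    {ζ : K} (hζ : IsPrimitiveRoot ζ (Nat.card G)) {f : G → K}
    (hf : f ∈ locCharRing 𝒪 K 𝔭 G) (hid : IsIdempotentElem f) (y : G) :
    f (pPrimePart p y) = f y := by
  have hinj := IsFractionRing.injective 𝒪 K
  obtain ⟨a, b, d, hd, ha, hb, hab⟩ := exists_mul_eq_sub_mem_of_mem_locCharRing p hp𝔭 hζ hf y
  have h01 (z : G) : f z = 0 ∨ f z = 1 := IsIdempotentElem.iff_eq_zero_or_one.1 (congrFun hid z)
  obtain h1 | h1 := h01 y <;> obtain h2 | h2 := h01 (pPrimePart p y) <;> rw [h1, h2] <;> exfalso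
  · rw [h1, zero_mul, ← map_zero (algebraMap 𝒪 K)] at ha
    rw [h2, one_mul] at hb
    rw [← hinj ha, ← hinj hb, zero_sub, neg_mem_iff] at hab
    exact hd hab
  · rw [h2, zero_mul, ← map_zero (algebraMap 𝒪 K)] at hb
    rw [h1, one_mul] at ha
    rw [← hinj ha, ← hinj hb, sub_zero] at hab
    exact hd hab

theorem isPrimitiveIdempotent_eFun {𝒪 : Type*} [CommRing 𝒪] [IsDedekindDomain 𝒪]
    {K : Type u} [Field K] [CharZero K] [Algebra 𝒪 K] [IsFractionRing 𝒪 K] {𝔭 : Ideal 𝒪}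
    [𝔭.IsMaximal] (p : ℕ) [Fact p.Prime] (hp𝔭 : (p : 𝒪) ∈ 𝔭) {G : Type u} [Group G] [Finite G]
    {ζ : K} (hζ : IsPrimitiveRoot ζ (Nat.card G)) {g : G} (hg : IsPRegular p g)
    (h : eFun p K g ∈ locCharRing 𝒪 K 𝔭 G) :
    IsPrimitiveIdempotent (⟨eFun p K g, h⟩ : locCharRing 𝒪 K 𝔭 G) := by
  have hself : eFun p K g g = 1 := by
    rw [eFun, pPrimePart_eq_self p hg, if_pos (IsConj.refl g)]
  refine ⟨Subtype.ext (funext fun x => ?_), fun h0 => ?_, ?_⟩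
  · simp [eFun]
  · have := congrFun (congrArg Subtype.val h0) g
    exact one_ne_zero (hself.symm.trans this)
  · rintro ⟨a, ha⟩ ⟨b, hb⟩ hia hib hab - habe
    have hab' (y : G) : a y * b y = 0 := congrFun (congrArg Subtype.val hab) y
    have habe' (y : G) : a y + b y = eFun p K g y := congrFun (congrArg Subtype.val habe) y
    have key {f : G → K} (hf : f ∈ locCharRing 𝒪 K 𝔭 G) (hi : IsIdempotentElem f) {y : G}
        (hy : f y ≠ 0) (hey : eFun p K g y ≠ 0) : f g ≠ 0 := by
      have hc : IsConj g (pPrimePart p y) := by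
        by_contra hc
        exact hey (if_neg hc)
      rwa [apply_eq_of_isConj_of_mem_locCharRing hf hc,
        apply_pPrimePart_of_isIdempotentElem p hp𝔭 hζ hf hi y]
    by_contra! hne
    obtain ⟨y, hy⟩ := Function.ne_iff.1 fun h0 : a = 0 => hne.1 (Subtype.ext h0)
    obtain ⟨z, hz⟩ := Function.ne_iff.1 fun h0 : b = 0 => hne.2 (Subtype.ext h0)
    have hag := key ha (congrArg Subtype.val hia) hy (by
      rwa [← habe', (mul_eq_zero.1 (hab' y)).resolve_left hy, add_zero])
    have hbg := key hb (congrArg Subtype.val hib) hz (by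
      rwa [← habe', (mul_eq_zero.1 (hab' z)).resolve_right hz, zero_add])
    exact mul_ne_zero hag hbg (hab' g)

variable {𝒪 : Type*} [CommRing 𝒪] [IsDomain 𝒪] [IsDedekindDomain 𝒪] [CharZero 𝒪]
variable {K : Type u} [Field K] [Algebra 𝒪 K] [IsFractionRing 𝒪 K]
variable {𝔭 : Ideal 𝒪} [𝔭.IsMaximal]

/-- For every `p`-regular conjugacy class `C` of `G` (with representative `g`),
the idempotent `e_C` (the characteristic function of the `p'`-section of `C`) belongs to
`𝒪_𝔭R(G)` and is a primitive idempotent there; the family of all the `e_C` consists of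
pairwise orthogonal idempotents summing to `1`. -/
theorem eFun_mem_and_primitive
    (p : ℕ) [Fact p.Prime] (hp : (p : 𝒪) ∈ 𝔭)
    {G : Type u} [Group G] [Finite G]
    (ζ : K) (hζ : IsPrimitiveRoot ζ (Nat.card G)) :
    (∀ g : G, IsPRegular p g → eFun p K g ∈ locCharRing 𝒪 K 𝔭 G) ∧
    (∀ (g : G), IsPRegular p g → ∀ h : eFun p K g ∈ locCharRing 𝒪 K 𝔭 G,
        IsPrimitiveIdempotent (⟨eFun p K g, h⟩ : locCharRing 𝒪 K 𝔭 G)) ∧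
    (∀ g g' : G, IsPRegular p g → IsPRegular p g' → ¬ IsConj g g' →
        eFun p K g * eFun p K g' = 0) ∧
    (∀ s : Finset G, (∀ y ∈ s, IsPRegular p y) →
        (∀ x : G, IsPRegular p x → ∃! y, y ∈ s ∧ IsConj y x) →
        ∑ y ∈ s, eFun p K y = 1) := by
  have : CharZero K := charZero_of_injective_algebraMap (IsFractionRing.injective 𝒪 K)
  refine ⟨fun g hg => eFun_mem_locCharRing p hp hζ hg,
    fun g hg h => isPrimitiveIdempotent_eFun p hp hζ hg h, fun g g' _ _ hgg' => ?_,
    fun s _ hs => ?_⟩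
  · funext x
    by_cases h : IsConj g (pPrimePart p x)
    · have h' : ¬ IsConj g' (pPrimePart p x) := fun h' => hgg' (h.trans h'.symm)
      simp only [eFun, Pi.mul_apply, if_neg h', mul_zero, Pi.zero_apply]
    · simp only [eFun, Pi.mul_apply, if_neg h, zero_mul, Pi.zero_apply]
  · funext x
    obtain ⟨y, ⟨hys, hy⟩, huniq⟩ := hs _ (pPrimePart_isPRegular p x)
    rw [Finset.sum_apply, Finset.sum_eq_single_of_mem y hys]
    · exact if_pos hy
    · intro z hz hzy
      exact if_neg fun hc => hzy (huniq z ⟨hz, hc⟩)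
end

section
/- Let p^e be the exponent of a Sylow p-subgroup of G. Then f^{p^e} = 0 for every element f of the Jacobson radical Rad kR(G). -/
open scoped TensorProduct Classical

namespace Matrix

variable {R ι κ : Type*} [CommSemiring R] [Fintype ι] [DecidableEq ι]

theorem sum_walk_eq_sum_pow (M : Matrix ι ι R) (n : ℕ) (f : ι → ι → R) :
    ∑ a : Fin (n + 1) → ι, f (a 0) (a (Fin.last n)) * ∏ i : Fin n, M (a i.castSucc) (a i.succ) =
      ∑ x, ∑ y, f x y * (M ^ n) x y := by
  induction n generalizing f with
  | zero =>
    rw [← (Equiv.funUnique (Fin 1) ι).symm.sum_comp]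
    simp [Matrix.one_apply]
  | succ n ih =>
    rw [← (Fin.consEquiv fun _ => ι).sum_comp, Fintype.sum_prod_type_right]
    have key : ∀ a : Fin (n + 1) → ι, ∑ x, f x (a (Fin.last n)) *
        (M x (a 0) * ∏ i : Fin n, M (a i.castSucc) (a i.succ)) =
        (∑ x, f x (a (Fin.last n)) * M x (a 0)) * ∏ i : Fin n, M (a i.castSucc) (a i.succ) := by
      intro a
      simp only [Finset.sum_mul, mul_assoc]
    simp only [Fin.consEquiv_apply, Fin.prod_univ_succ, Fin.cons_zero, ← Fin.succ_last,
      Fin.cons_succ, Fin.castSucc_zero, ← Fin.succ_castSucc, key]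
    rw [ih fun x y => ∑ z, f z y * M z x]
    simp only [pow_succ', Matrix.mul_apply, Finset.sum_mul, Finset.mul_sum, mul_assoc]
    rw [Finset.sum_comm]
    conv_rhs => rw [Finset.sum_comm]
    refine Finset.sum_congr rfl fun y _ => ?_
    exact Finset.sum_comm

theorem sum_cyclic_walk_eq_trace_pow (M : Matrix ι ι R) (n : ℕ) [NeZero n] :
    ∑ a : ZMod n → ι, ∏ i, M (a i) (a (i + 1)) = (M ^ n).trace := by
  obtain _ | n := n
  · exact absurd rfl (NeZero.ne 0)
  change ∑ a : Fin (n + 1) → ι, ∏ i : Fin (n + 1), M (a i) (a (i + 1)) = _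
  simp only [Fin.prod_univ_castSucc, Fin.last_add_one, Fin.coeSucc_eq_succ]
  simp only [mul_comm _ (M _ _)]
  rw [M.sum_walk_eq_sum_pow n fun x y => M y x]
  simp only [pow_succ', trace, diag, mul_apply]
  exact Finset.sum_comm

theorem sum_cyclic_walk_step_eq_trace_pow (M : Matrix ι ι R) (p : ℕ) [Fact p.Prime]
    {j : ZMod p} (hj : j ≠ 0) :
    ∑ a : ZMod p → ι, ∏ i, M (a i) (a (i + j)) = (M ^ p).trace := by
  rw [← M.sum_cyclic_walk_eq_trace_pow p,
    ← ((Equiv.mulRight₀ j hj).arrowCongr (Equiv.refl ι)).sum_comp]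
  refine Finset.sum_congr rfl fun a _ => ?_
  rw [← Equiv.prod_comp (Equiv.mulRight₀ j hj)]
  refine Finset.prod_congr rfl fun i _ => ?_
  have h : i * j + j = (i + 1) * j := by ring
  simp [Equiv.arrowCongr, h, hj]

/-- The Kronecker power of a matrix, with rows and columns indexed by functions `κ → ι`. -/
def kroneckerPow (κ : Type*) [Fintype κ] (M : Matrix ι ι R) : Matrix (κ → ι) (κ → ι) R :=
  of fun a b => ∏ i, M (a i) (b i)

omit [Fintype ι] in
theorem kroneckerPow_one [Fintype κ] [DecidableEq κ] : kroneckerPow κ (1 : Matrix ι ι R) = 1 := by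
  ext a b
  simp only [kroneckerPow, of_apply, one_apply, Finset.prod_ite_zero]
  simp [funext_iff]

omit [DecidableEq ι] in
theorem kroneckerPow_mul [Fintype κ] [DecidableEq κ] (M N : Matrix ι ι R) :
    kroneckerPow κ (M * N) = kroneckerPow κ M * kroneckerPow κ N := by
  ext a b
  simp only [kroneckerPow, of_apply, mul_apply, Finset.prod_univ_sum, Fintype.piFinset_univ,
    Finset.prod_mul_distrib]

end Matrix

theorem mem_charSet_of_isIdempotentElem {K G V : Type u} [Field K] [Group G] [AddCommGroup V]
    [Module K V] [FiniteDimensional K V] (ρ : Representation K G V) (e : Module.End K V)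
    (he : IsIdempotentElem e) (hρ : ∀ g, Commute (ρ g) e) :
    (fun g => LinearMap.trace K V (ρ g * e)) ∈ charSet K G := by
  have hmem : ∀ g, ∀ x ∈ LinearMap.range e, ρ g x ∈ LinearMap.range e := by
    rintro g _ ⟨x, rfl⟩
    exact ⟨ρ g x, (LinearMap.congr_fun (hρ g).eq x).symm⟩
  let ρ' : Representation K G (LinearMap.range e) :=
    { toFun g := (ρ g).restrict (hmem g)
      map_one' := by ext; simp
      map_mul' g h := by ext; simp }
  refine ⟨FDRep.of ρ', funext fun g => ?_⟩
  have hr : ∀ x, (ρ g * e) x ∈ LinearMap.range e := fun x => hmem g _ ⟨x, rfl⟩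
  rw [← LinearMap.trace_restrict_eq_of_forall_mem _ _ hr]
  change _ = LinearMap.trace K _ (ρ' g)
  congr 1
  ext ⟨_, x, rfl⟩
  simpa [ρ'] using congrArg (ρ g) (LinearMap.congr_fun he.eq x)

/-- The operator on functions on `ZMod p → ι` averaging over cyclic shifts of the argument. -/
noncomputable def cyclicAverage (K ι : Type*) [Field K] (p : ℕ) [NeZero p] :
    Module.End K ((ZMod p → ι) → K) :=
  (p : K)⁻¹ • ∑ j : ZMod p, LinearMap.funLeft K K fun (a : ZMod p → ι) i => a (i + j)

section CyclicAverage

variable {K ι : Type*} [Field K] {p : ℕ} [NeZero p]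

theorem cyclicAverage_apply (v : (ZMod p → ι) → K) (a : ZMod p → ι) :
    cyclicAverage K ι p v a = (p : K)⁻¹ * ∑ j : ZMod p, v fun i => a (i + j) := by
  simp [cyclicAverage, LinearMap.sum_apply, LinearMap.funLeft_apply]

theorem isIdempotentElem_cyclicAverage (hp : (p : K) ≠ 0) :
    IsIdempotentElem (cyclicAverage K ι p) := by
  refine LinearMap.ext fun v => funext fun a => ?_
  have h : ∀ j : ZMod p, ∑ l : ZMod p, v (fun i => a (i + l + j)) =
      ∑ l : ZMod p, v (fun i => a (i + l)) := by
    intro j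
    rw [← Equiv.sum_comp (Equiv.addRight j) fun l => v fun i => a (i + l)]
    simp [add_assoc]
  have h' : ∀ j : ZMod p, ∑ l : ZMod p, v (fun i => a (i + j + l)) =
      ∑ l : ZMod p, v (fun i => a (i + l)) := by
    intro j
    rw [← h j]
    simp [add_right_comm]
  simp only [Module.End.mul_apply, cyclicAverage_apply, h', add_right_comm]
  simp [hp, ZMod.card]

variable [Fintype ι] [DecidableEq ι]

theorem commute_kroneckerPow_cyclicAverage (M : Matrix ι ι K) :
    Commute (Matrix.toLin' (M.kroneckerPow (ZMod p))) (cyclicAverage K ι p) := by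
  refine LinearMap.ext fun v => funext fun a => ?_
  simp only [Module.End.mul_apply, cyclicAverage_apply, Matrix.toLin'_apply, Matrix.mulVec,
    dotProduct, Finset.mul_sum]
  rw [Finset.sum_comm]
  refine Finset.sum_congr rfl fun j _ => ?_
  rw [← Equiv.sum_comp ((Equiv.addRight j).arrowCongr (Equiv.refl ι))]
  refine Finset.sum_congr rfl fun b _ => ?_
  have h : M.kroneckerPow (ZMod p) a ((Equiv.addRight j).arrowCongr (Equiv.refl ι) b) =
      M.kroneckerPow (ZMod p) (fun i => a (i + j)) b := by
    simp only [Matrix.kroneckerPow, Matrix.of_apply]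
    rw [← Equiv.prod_comp (Equiv.addRight j)]
    simp [Equiv.arrowCongr]
  rw [h]
  simp [Equiv.arrowCongr, Function.comp_def, mul_left_comm]

theorem trace_kroneckerPow_mul_cyclicAverage [Fact p.Prime] (hp : (p : K) ≠ 0)
    (M : Matrix ι ι K) :
    p * LinearMap.trace K _ (Matrix.toLin' (M.kroneckerPow (ZMod p)) * cyclicAverage K ι p) =
      M.trace ^ p + (p - 1) * (M ^ p).trace := by
  have hj : ∀ j : ZMod p, ∑ a : ZMod p → ι, M.kroneckerPow (ZMod p) (fun i => a (i + j)) a =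
      if j = 0 then M.trace ^ p else (M ^ p).trace := by
    intro j
    split_ifs with h
    · simp only [h, add_zero, Matrix.kroneckerPow, Matrix.of_apply, Matrix.trace, Matrix.diag]
      have := Finset.prod_univ_sum (fun _ : ZMod p => Finset.univ) (fun _ i => M i i)
      simpa [ZMod.card] using this.symm
    · rw [← Matrix.trace_transpose (M ^ p), Matrix.transpose_pow,
        ← M.transpose.sum_cyclic_walk_step_eq_trace_pow p h]
      rfl
  rw [LinearMap.trace_mul_comm, LinearMap.trace_eq_matrix_trace K (Pi.basisFun K _)]
  simp only [Matrix.trace, Matrix.diag, LinearMap.toMatrix_apply, Pi.basisFun_apply,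
    Pi.basisFun_repr, Module.End.mul_apply, cyclicAverage_apply, Matrix.toLin'_apply,
    Matrix.mulVec_single_one, Matrix.col_apply]
  rw [← Finset.mul_sum, Finset.sum_comm, mul_inv_cancel_left₀ hp]
  simp only [hj]
  rw [← Finset.add_sum_erase _ _ (Finset.mem_univ (0 : ZMod p)), if_pos rfl,
    Finset.sum_congr rfl fun j hj => if_neg (Finset.ne_of_mem_erase hj)]
  simp [ZMod.card, Finset.card_erase_of_mem, Nat.cast_sub (NeZero.one_le (n := p)), Matrix.trace]

end CyclicAverage

theorem exists_mem_charSet_mul_eq {K G : Type u} [Field K] [CharZero K] [Group G] (p : ℕ)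
    [Fact p.Prime] {χ : G → K} (hχ : χ ∈ charSet K G) :
    ∃ α ∈ charSet K G, ∀ g, p * α g = χ g ^ p + (p - 1) * χ (g ^ p) := by
  obtain ⟨V, rfl⟩ := hχ
  have hp : (p : K) ≠ 0 := Nat.cast_ne_zero.mpr (Fact.out : p.Prime).ne_zero
  let b := Module.finBasis K V
  let ρ : Representation K G ((ZMod p → Fin (Module.finrank K V)) → K) :=
    { toFun g := Matrix.toLin' ((LinearMap.toMatrix b b (V.ρ g)).kroneckerPow (ZMod p))
      map_one' := by
        rw [map_one, LinearMap.toMatrix_one, Matrix.kroneckerPow_one, Matrix.toLin'_one]; rfl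
      map_mul' g h := by
        rw [map_mul, LinearMap.toMatrix_mul, Matrix.kroneckerPow_mul, Matrix.toLin'_mul]; rfl }
  refine ⟨_, mem_charSet_of_isIdempotentElem ρ _ (isIdempotentElem_cyclicAverage hp)
    fun g => commute_kroneckerPow_cyclicAverage _, fun g => ?_⟩
  refine (trace_kroneckerPow_mul_cyclicAverage hp _).trans ?_
  simp only [FDRep.character, map_pow, LinearMap.trace_eq_matrix_trace K b,
    LinearMap.toMatrix_pow]

/-- The elements of a ring having a multiple by an integer prime to `p` in the subring `R`. -/
def Subring.primeToSaturation {A : Type*} [CommRing A] (R : Subring A) (p : ℕ) : Subring A where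
  carrier := {x | ∃ d : ℕ, d.Coprime p ∧ d * x ∈ R}
  mul_mem' := by
    rintro x y ⟨c, hc, hx⟩ ⟨d, hd, hy⟩
    refine ⟨c * d, hc.mul_left hd, ?_⟩
    convert R.mul_mem hx hy using 1
    push_cast; ring
  one_mem' := ⟨1, by simp, by simp⟩
  add_mem' := by
    rintro x y ⟨c, hc, hx⟩ ⟨d, hd, hy⟩
    refine ⟨c * d, hc.mul_left hd, ?_⟩
    convert R.add_mem (R.mul_mem (natCast_mem R d) hx) (R.mul_mem (natCast_mem R c) hy) using 1
    push_cast; ring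
  zero_mem' := ⟨1, by simp, by simp⟩
  neg_mem' := by
    rintro x ⟨c, hc, hx⟩
    exact ⟨c, hc, by simpa using hx⟩

section FrobeniusLift

variable {A : Type*} [CommRing A] {R : Subring A} {p : ℕ}

theorem Subring.le_primeToSaturation : R ≤ R.primeToSaturation p :=
  fun x hx => ⟨1, by simp, by simpa using hx⟩

theorem Subring.mem_primeToSaturation_of_natCast_mul_mem {d : ℕ} (hd : d.Coprime p) {x : A}
    (hx : d * x ∈ R.primeToSaturation p) : x ∈ R.primeToSaturation p := by
  obtain ⟨c, hc, hx⟩ := hx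
  exact ⟨c * d, hc.mul_left hd, by simpa [mul_assoc] using hx⟩

/-- If `x ∈ R` is divisible by `p` in the saturation of `R`, it is divisible by `p` in `R`. -/
theorem Subring.exists_eq_natCast_mul {x s : A} (hx : x ∈ R) (hs : s ∈ R.primeToSaturation p)
    (h : x = p * s) : ∃ y ∈ R, x = p * y := by
  obtain ⟨d, hd, hds⟩ := hs
  obtain ⟨u, v, huv⟩ := Int.isCoprime_iff_gcd_eq_one.mpr (show Int.gcd d p = 1 by simpa using hd)
  have huv' : (u : A) * d + v * p = 1 := by exact_mod_cast congrArg (Int.cast (R := A)) huv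
  refine ⟨u * (d * s) + v * x, R.add_mem (R.mul_mem (intCast_mem R u) hds)
    (R.mul_mem (intCast_mem R v) hx), ?_⟩
  linear_combination (-1 : A) * x * huv' + u * d * h

/-- `ψ` maps `x` into `S`, and agrees there with the `p`-th power modulo `p`. -/
def IsFrobeniusAt (p : ℕ) (S : Subring A) (ψ : A →+* A) (x : A) : Prop :=
  ψ x ∈ S ∧ ∃ s ∈ S, x ^ p = ψ x + p * s

variable {S : Subring A} {ψ : A →+* A} [Fact p.Prime]

theorem isFrobeniusAt_of_mem_closure {T : Set A} (hTS : T ⊆ S)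
    (h : ∀ x ∈ T, IsFrobeniusAt p S ψ x) {x : A} (hx : x ∈ Subring.closure T) :
    IsFrobeniusAt p S ψ x := by
  have hp : p.Prime := Fact.out
  have hle : Subring.closure T ≤ S := Subring.closure_le.mpr hTS
  induction hx using Subring.closure_induction with
  | mem x hx => exact h x hx
  | zero => exact ⟨by simp, 0, S.zero_mem, by simp [hp.ne_zero]⟩
  | one => exact ⟨by simp, 0, S.zero_mem, by simp⟩
  | add x y hx hy ihx ihy =>
    obtain ⟨hψx, s, hs, hxs⟩ := ihx
    obtain ⟨hψy, t, ht, hyt⟩ := ihy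
    obtain ⟨r, hr⟩ := exists_add_pow_prime_eq hp (⟨x, hle hx⟩ : S) ⟨y, hle hy⟩
    have hr' := congrArg (Subtype.val) hr
    push_cast at hr'
    refine ⟨by simpa using S.add_mem hψx hψy, s + t + x * y * r, S.add_mem (S.add_mem hs ht)
      (S.mul_mem (S.mul_mem (hle hx) (hle hy)) r.2), ?_⟩
    rw [hr', hxs, hyt, map_add]
    ring
  | neg x hx ih =>
    obtain ⟨hψx, s, hs, hxs⟩ := ih
    obtain ⟨r, hr⟩ := exists_add_pow_prime_eq hp (⟨x, hle hx⟩ : S) (-⟨x, hle hx⟩)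
    have hr' := congrArg (Subtype.val) hr
    push_cast at hr'
    rw [add_neg_cancel, zero_pow hp.ne_zero] at hr'
    refine ⟨by simpa using hψx, x * x * r - s, S.sub_mem (S.mul_mem (S.mul_mem (hle hx) (hle hx))
      r.2) hs, ?_⟩
    rw [map_neg]
    linear_combination -hr' - hxs
  | mul x y hx hy ihx ihy =>
    obtain ⟨hψx, s, hs, hxs⟩ := ihx
    obtain ⟨hψy, t, ht, hyt⟩ := ihy
    refine ⟨by simpa using S.mul_mem hψx hψy, s * ψ y + ψ x * t + p * s * t, ?_, ?_⟩
    · exact S.add_mem (S.add_mem (S.mul_mem hs hψy) (S.mul_mem hψx ht))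
        (S.mul_mem (S.mul_mem (natCast_mem S p) hs) ht)
    · rw [mul_pow, hxs, hyt, map_mul]
      ring

theorem exists_pow_prime_eq_add {x y s : A} (hy : y ∈ S) (hs : s ∈ S) (h : x = y + p * s) :
    ∃ t ∈ S, x ^ p = y ^ p + p * t := by
  have hp : p.Prime := Fact.out
  obtain ⟨r, hr⟩ := exists_add_pow_prime_eq hp (⟨y, hy⟩ : S) (p * ⟨s, hs⟩)
  have hr' := congrArg (Subtype.val) hr
  push_cast at hr'
  refine ⟨p ^ (p - 1) * s ^ p + y * (p * s) * r, S.add_mem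
    (S.mul_mem (S.pow_mem (natCast_mem S p) _) (S.pow_mem hs p))
    (S.mul_mem (S.mul_mem hy (S.mul_mem (natCast_mem S p) hs)) r.2), ?_⟩
  rw [h, hr', mul_pow, ← mul_pow_sub_one hp.ne_zero (p : A)]
  ring

/-- A Frobenius lift on `R` extends to the saturation of `R`. -/
theorem IsFrobeniusAt.primeToSaturation
    (h : ∀ x ∈ R, IsFrobeniusAt p (R.primeToSaturation p) ψ x) {x : A}
    (hx : x ∈ R.primeToSaturation p) : IsFrobeniusAt p (R.primeToSaturation p) ψ x := by
  obtain ⟨d, hd, hdx⟩ := id hx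
  obtain ⟨hψ, s, hs, hxs⟩ := h _ hdx
  rw [map_mul, map_natCast] at hψ hxs
  obtain ⟨c, hc⟩ : (p : ℤ) ∣ (d : ℤ) ^ p - d := by
    rw [← ZMod.intCast_zmod_eq_zero_iff_dvd _ p]; simp
  have hc' : (d : A) ^ p - d = p * c := by exact_mod_cast congrArg (Int.cast (R := A)) hc
  have hψx := Subring.mem_primeToSaturation_of_natCast_mul_mem hd hψ
  have key : (d : A) * (x ^ p - ψ x) = p * (s - c * x ^ p) := by
    linear_combination hxs - x ^ p * hc'
  obtain ⟨u, v, huv⟩ := Int.isCoprime_iff_gcd_eq_one.mpr (show Int.gcd d p = 1 by simpa using hd)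
  have huv' : (u : A) * d + v * p = 1 := by exact_mod_cast congrArg (Int.cast (R := A)) huv
  have hxS := (R.primeToSaturation p).pow_mem hx p
  refine ⟨hψx, u * (s - c * x ^ p) + v * (x ^ p - ψ x), ?_, ?_⟩
  · exact add_mem (mul_mem (intCast_mem _ u) (sub_mem hs (mul_mem (intCast_mem _ c) hxS)))
      (mul_mem (intCast_mem _ v) (sub_mem hxS hψx))
  · linear_combination u * key - (x ^ p - ψ x) * huv'

theorem IsFrobeniusAt.exists_pow_pow_eq (h : ∀ x ∈ S, IsFrobeniusAt p S ψ x) (n : ℕ) {x : A}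
    (hx : x ∈ S) : ψ^[n] x ∈ S ∧ ∃ s ∈ S, x ^ p ^ n = ψ^[n] x + p * s := by
  induction n with
  | zero => exact ⟨hx, 0, S.zero_mem, by simp⟩
  | succ n ih =>
    obtain ⟨hn, s, hs, hxs⟩ := ih
    obtain ⟨hψ, t, ht, hxt⟩ := h _ hn
    obtain ⟨r, hr, hxr⟩ := exists_pow_prime_eq_add hn hs hxs
    rw [Function.iterate_succ_apply']
    refine ⟨hψ, t + r, S.add_mem ht hr, ?_⟩
    rw [pow_succ, pow_mul, hxr, hxt]
    ring

end FrobeniusLift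

theorem pow_pow_add_totient_eq {G : Type*} [Group G] [Finite G] {p : ℕ} [Fact p.Prime]
    (P : Sylow p G) {e : ℕ} (he : Monoid.exponent P = p ^ e) (g : G) :
    g ^ p ^ (e + (ordCompl[p] (Nat.card G)).totient) = g ^ p ^ e := by
  have hp : p.Prime := Fact.out
  obtain ⟨a, m, hm, hn⟩ := Nat.exists_eq_pow_mul_and_not_dvd (orderOf_pos g).ne' p hp.ne_one
  have hm0 : m ≠ 0 := by rintro rfl; simp at hm
  have hcop : m.Coprime p := (hp.coprime_iff_not_dvd.mpr hm).symm
  have hga : orderOf (g ^ m) = p ^ a := by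
    rw [orderOf_pow_of_dvd hm0 (hn ▸ dvd_mul_left _ _), hn, Nat.mul_div_cancel _ hm0.bot_lt]
  have hae : p ^ a ∣ p ^ e := by
    have hpg : IsPGroup p (Subgroup.zpowers (g ^ m)) :=
      IsPGroup.of_card (n := a) (by rw [Nat.card_zpowers, hga])
    obtain ⟨Q, hQ⟩ := hpg.exists_le_sylow
    rw [← hga, ← he, Monoid.exponent_eq_of_mulEquiv (P.equiv Q),
      ← Subgroup.orderOf_mk (g ^ m) (hQ (Subgroup.mem_zpowers _))]
    exact Monoid.order_dvd_exponent _
  have hord : orderOf (g ^ p ^ e) ∣ m := by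
    rw [orderOf_dvd_iff_pow_eq_one, ← pow_mul, ← orderOf_dvd_iff_pow_eq_one, hn]
    exact Nat.mul_dvd_mul_right hae m
  have hmM : m ∣ ordCompl[p] (Nat.card G) := by
    refine (hcop.pow_right ((Nat.card G).factorization p)).dvd_of_dvd_mul_left ?_
    rw [Nat.ordProj_mul_ordCompl_eq_self]
    exact ((Dvd.intro_left _ rfl).trans hn.symm.dvd).trans (orderOf_dvd_natCard g)
  have hmod : p ^ (ordCompl[p] (Nat.card G)).totient ≡ 1 [MOD orderOf (g ^ p ^ e)] :=
    (Nat.ModEq.pow_totient (Nat.coprime_ordCompl hp Nat.card_pos.ne')).of_dvd (hord.trans hmM)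
  rw [pow_add, pow_mul]
  simpa using pow_eq_pow_iff_modEq.mpr hmod

section BaseChange

variable {k R : Type*} [Field k] [CommRing R] {p : ℕ} [Fact p.Prime] [CharP k p] {e c : ℕ}

omit [Fact p.Prime] in
theorem natCast_prime_tmul (a : k) (y : R) : a ⊗ₜ[ℤ] ((p : R) * y) = 0 := by
  have h : (p : R) * y = (p : ℤ) • y := by simp
  rw [h, ← TensorProduct.smul_tmul]
  simp

theorem isIntegral_tensorProduct_of_pow_eq (hc : c ≠ 0)
    (h : ∀ x : R, ∃ y, x ^ p ^ (e + c) = x ^ p ^ e + p * y) :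
    Algebra.IsIntegral k (k ⊗[ℤ] R) := by
  refine ⟨fun f => ?_⟩
  induction f with
  | zero => exact isIntegral_zero
  | add f g hf hg => exact hf.add hg
  | tmul a x =>
    have hx : IsIntegral k ((1 : k) ⊗ₜ[ℤ] x) := by
      have hlt : p ^ e < p ^ (e + c) :=
        Nat.pow_lt_pow_right (Fact.out : p.Prime).one_lt (by omega)
      refine ⟨Polynomial.X ^ p ^ (e + c) - Polynomial.X ^ p ^ e, Polynomial.monic_X_pow_sub ?_, ?_⟩
      · rw [Polynomial.degree_X_pow]
        exact_mod_cast hlt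
      · obtain ⟨y, hy⟩ := h x
        simp [Algebra.TensorProduct.tmul_pow, hy, TensorProduct.tmul_add, natCast_prime_tmul]
    simpa [TensorProduct.smul_tmul'] using hx.smul a

theorem pow_eq_zero_of_mem_jacobson_tensorProduct [Module.Flat ℤ R] (hc : c ≠ 0)
    (h : ∀ x : R, ∃ y, x ^ p ^ (e + c) = x ^ p ^ e + p * y) {f : k ⊗[ℤ] R}
    (hf : f ∈ (⊥ : Ideal (k ⊗[ℤ] R)).jacobson) : f ^ p ^ e = 0 := by
  nontriviality k ⊗[ℤ] R
  have := isIntegral_tensorProduct_of_pow_eq (k := k) hc h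
  have : IsJacobsonRing (k ⊗[ℤ] R) := isJacobsonRing_of_isIntegral (R := k)
  have : CharP (k ⊗[ℤ] R) p := charP_of_injective_algebraMap (algebraMap k _).injective p
  let σ : k →ₐ[ℤ] k := (iterateFrobenius k p c).toIntAlgHom
  let τ : k ⊗[ℤ] R →ₐ[ℤ] k ⊗[ℤ] R := Algebra.TensorProduct.map σ (AlgHom.id ℤ R)
  have hτ : Function.Injective τ :=
    Module.Flat.rTensor_preserves_injective_linearMap (M := R) σ.toLinearMap
      (iterateFrobenius k p c).injective
  have hpow : ∀ f : k ⊗[ℤ] R, f ^ p ^ (e + c) = τ (f ^ p ^ e) := by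
    intro f
    induction f with
    | zero => simp [(Fact.out : p.Prime).ne_zero]
    | add f g hf hg => rw [add_pow_char_pow, add_pow_char_pow, map_add, hf, hg]
    | tmul a x =>
      obtain ⟨y, hy⟩ := h x
      rw [Algebra.TensorProduct.tmul_pow, hy, TensorProduct.tmul_add, natCast_prime_tmul]
      simp [τ, σ, Algebra.TensorProduct.tmul_pow, iterateFrobenius_def, pow_add, pow_mul]
  rw [← Ideal.radical_eq_jacobson] at hf
  obtain ⟨n, hn⟩ := hf
  have hdesc : ∀ j, f ^ p ^ (e + j) = 0 → f ^ p ^ e = 0 := by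
    intro j
    induction j with
    | zero => exact id
    | succ j ih =>
      refine fun hj => ih (hτ ?_)
      rw [map_zero, pow_add p e, mul_comm, pow_mul, ← hpow, ← pow_mul, ← pow_add]
      exact pow_eq_zero_of_le
        (Nat.pow_le_pow_right (Fact.out : p.Prime).pos (by omega)) hj
  refine hdesc n (pow_eq_zero_of_le ?_ (Ideal.mem_bot.mp hn))
  exact (Nat.lt_pow_self (Fact.out : p.Prime).one_lt).le.trans
    (Nat.pow_le_pow_right (Fact.out : p.Prime).pos (by omega))

end BaseChange

theorem exists_pow_pow_eq_of_mem_charRing {K G : Type u} [Field K] [CharZero K] [Group G]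
    [Finite G] {p : ℕ} [Fact p.Prime] (P : Sylow p G) {e : ℕ} (he : Monoid.exponent P = p ^ e)
    {x : G → K} (hx : x ∈ charRing K G) :
    ∃ y ∈ charRing K G,
      x ^ p ^ (e + (ordCompl[p] (Nat.card G)).totient) = x ^ p ^ e + p * y := by
  have hp : p.Prime := Fact.out
  let S := (charRing K G).primeToSaturation p
  let ψ : (G → K) →+* (G → K) := RingHom.pi fun g => Pi.evalRingHom (fun _ => K) (g ^ p)
  have hψ : ∀ n x g, ψ^[n] x g = x (g ^ p ^ n) := by
    intro n
    induction n with
    | zero => simp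
    | succ n ih =>
      intro x g
      rw [Function.iterate_succ_apply, ih, pow_succ, pow_mul]
      rfl
  have hchar : ∀ χ ∈ charSet K G, IsFrobeniusAt p S ψ χ := by
    intro χ hχ
    obtain ⟨α, hα, h⟩ := exists_mem_charSet_mul_eq p hχ
    have h' : p * α = χ ^ p + ((p - 1 : ℕ) : G → K) * ψ χ := by
      ext g
      rw [Nat.cast_sub hp.one_le]
      simpa using! h g
    have hαS : α ∈ S := Subring.le_primeToSaturation (Subring.subset_closure hα)
    have hψS : ψ χ ∈ S := by
      refine ⟨p - 1, (Nat.coprime_self_sub_left hp.one_le).mpr (Nat.coprime_one_left p), ?_⟩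
      rw [← sub_eq_of_eq_add' h']
      exact sub_mem (mul_mem (natCast_mem _ p) (Subring.subset_closure hα))
        (pow_mem (Subring.subset_closure hχ) p)
    refine ⟨hψS, α - ψ χ, sub_mem hαS hψS, ?_⟩
    rw [Nat.cast_sub hp.one_le, Nat.cast_one] at h'
    linear_combination -h'
  have hS : ∀ x ∈ S, IsFrobeniusAt p S ψ x := fun x => IsFrobeniusAt.primeToSaturation fun x =>
    isFrobeniusAt_of_mem_closure
      (Subring.subset_closure.trans (Subring.le_primeToSaturation (R := charRing K G))) hchar
  have hxS : x ∈ S := Subring.le_primeToSaturation hx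
  obtain ⟨-, s, hs, hxs⟩ := IsFrobeniusAt.exists_pow_pow_eq hS e hxS
  obtain ⟨-, t, ht, hxt⟩ :=
    IsFrobeniusAt.exists_pow_pow_eq hS (e + (ordCompl[p] (Nat.card G)).totient) hxS
  have hit : ψ^[e + (ordCompl[p] (Nat.card G)).totient] x = ψ^[e] x :=
    funext fun g => by rw [hψ, hψ, pow_pow_add_totient_eq P he]
  rw [hit] at hxt
  obtain ⟨y, hy, hxy⟩ := Subring.exists_eq_natCast_mul (p := p)
    (sub_mem (pow_mem hx (p ^ (e + (ordCompl[p] (Nat.card G)).totient)))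
      (pow_mem hx (p ^ e))) (sub_mem ht hs) (by linear_combination hxt - hxs)
  exact ⟨y, hy, by linear_combination hxy⟩

variable {𝒪 : Type*} [CommRing 𝒪] [IsDomain 𝒪] [IsDedekindDomain 𝒪] [CharZero 𝒪]
variable {K : Type u} [Field K] [Algebra 𝒪 K] [IsFractionRing 𝒪 K]
variable {𝔭 : Ideal 𝒪} [𝔭.IsMaximal]

/-- Let `p^e` be the exponent of a Sylow `p`-subgroup of `G`.  Then
`f ^ (p^e) = 0` for every element `f` of the Jacobson radical of `kR(G)`. -/
theorem radical_pow_exponent_eq_zero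
    (p : ℕ) [Fact p.Prime] (hp : (p : 𝒪) ∈ 𝔭)
    {G : Type u} [Group G] [Finite G]
    (ζ : K) (hζ : IsPrimitiveRoot ζ (Nat.card G))
    (P : Sylow p G) (e : ℕ) (he : Monoid.exponent P = p ^ e) :
    ∀ f ∈ (⊥ : Ideal ((𝒪 ⧸ 𝔭) ⊗[ℤ] charRing K G)).jacobson, f ^ (p ^ e) = 0 := by
  have hp' : p.Prime := Fact.out
  have : CharZero K := charZero_of_injective_algebraMap (IsFractionRing.injective 𝒪 K)
  let _ : Field (𝒪 ⧸ 𝔭) := Ideal.Quotient.field 𝔭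
  have : CharP (𝒪 ⧸ 𝔭) p := by
    refine (CharP.charP_iff_prime_eq_zero hp').mpr ?_
    simpa using Ideal.Quotient.eq_zero_iff_mem.mpr hp
  have : Module.IsTorsionFree ℤ (charRing K G) :=
    Function.Injective.moduleIsTorsionFree (N := G → K) Subtype.val Subtype.val_injective
      fun _ _ => rfl
  refine fun f hf => pow_eq_zero_of_mem_jacobson_tensorProduct
    (Nat.totient_pos.mpr (Nat.ordCompl_pos p (Nat.card_pos (α := G)).ne')).ne' (fun x => ?_) hf
  obtain ⟨y, hy, hxy⟩ := exists_pow_pow_eq_of_mem_charRing P he x.2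
  exact ⟨⟨y, hy⟩, Subtype.ext hxy⟩
end
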